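/- arXiv:2207.11204 — 2 statements merged into one kernel-verified Lean document; each statement's English description precedes it below -/
import Mathlib

section
/- Under Assumption 1, for all k, ℓ ∈ ℕ₀ one has P(S₊ⁱ ≥ k, S₋ⁱ ≥ ℓ) = P(S₊ⁱ ≥ k + ℓ) = P(S₋ⁱ ≥ k + ℓ). -/
open MeasureTheory Filter Set ENNReal

noncomputable section

/-- The cluster `C(ω) = {t : I_t(ω) = 1}` of a binary process. -/
def clusterSet {Ω : Type*} (I : ℤ → Ω → Bool) (ω : Ω) : Set ℤ :=
  {t : ℤ | I t ω = true}

/-- Inspected cluster size `Sⁱ(ω) = Σ_{t ∈ ℤ} I_t(ω) ∈ ℕ ∪ {∞}`. -/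
def SiFn {Ω : Type*} (I : ℤ → Ω → Bool) (ω : Ω) : ℕ∞ :=
  {t : ℤ | I t ω = true}.encard

/-- Forward inspected cluster size `S₊ⁱ(ω) = Σ_{t ≥ 1} I_t(ω) ∈ ℕ₀ ∪ {∞}`. -/
def SplusFn {Ω : Type*} (I : ℤ → Ω → Bool) (ω : Ω) : ℕ∞ :=
  {t : ℤ | 0 < t ∧ I t ω = true}.encard

/-- Backward inspected cluster size `S₋ⁱ(ω) = Σ_{t ≤ -1} I_t(ω) ∈ ℕ₀ ∪ {∞}`. -/
def SminusFn {Ω : Type*} (I : ℤ → Ω → Bool) (ω : Ω) : ℕ∞ :=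
  {t : ℤ | t < 0 ∧ I t ω = true}.encard

/-- The shift on binary sequences. -/
def shiftSeq (t : ℤ) (x : ℤ → Bool) : ℤ → Bool := fun s => x (s + t)

lemma measurable_shiftSeq (t : ℤ) : Measurable (shiftSeq t) :=
  measurable_pi_lambda _ fun s => measurable_pi_apply (s + t)

lemma measurableSet_coord (t : ℤ) (b : Bool) : MeasurableSet {x : ℤ → Bool | x t = b} :=
  measurable_pi_apply (X := fun _ : ℤ => Bool) t (measurableSet_singleton b)

/-- At least `k` ones after zero and at least `l` ones before zero. -/
def cntSet (k l : ℕ) : Set (ℤ → Bool) :=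
  {x | (k : ℕ∞) ≤ {t : ℤ | 0 < t ∧ x t = true}.encard ∧
    (l : ℕ∞) ≤ {t : ℤ | t < 0 ∧ x t = true}.encard}

lemma measurableSet_le_encard (p : ℤ → Prop) (k : ℕ) :
    MeasurableSet {x : ℤ → Bool | (k : ℕ∞) ≤ {t : ℤ | p t ∧ x t = true}.encard} := by
  have h : {x : ℤ → Bool | (k : ℕ∞) ≤ {t : ℤ | p t ∧ x t = true}.encard}
      = ⋃ F ∈ {F : Finset ℤ | F.card = k ∧ ∀ t ∈ F, p t},
          ⋂ t ∈ F, {x : ℤ → Bool | x t = true} := by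
    ext x
    simp only [mem_ofPred_eq, mem_iUnion, mem_iInter, exists_prop]
    constructor
    · intro h
      obtain ⟨s, hs, hsk⟩ := Set.exists_subset_encard_eq h
      have hfin : s.Finite := Set.finite_of_encard_eq_coe hsk
      refine ⟨hfin.toFinset, ⟨?_, ?_⟩, ?_⟩
      · rw [hfin.encard_eq_coe_toFinset_card] at hsk
        exact_mod_cast hsk
      · intro t ht
        exact (hs (by simpa using ht)).1
      · intro t ht
        exact (hs (by simpa using ht)).2
    · rintro ⟨F, ⟨hk, hp⟩, hx⟩
      have : (F : Set ℤ) ⊆ {t : ℤ | p t ∧ x t = true} := fun t ht => ⟨hp t ht, hx t ht⟩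
      have h2 := Set.encard_le_encard this
      rwa [Set.encard_coe_eq_coe_finsetCard, hk] at h2
  rw [h]
  refine MeasurableSet.biUnion (Set.to_countable _) fun F _ => ?_
  exact Finset.measurableSet_biInter F fun t _ => measurableSet_coord t true

lemma measurableSet_cntSet (k l : ℕ) : MeasurableSet (cntSet k l) :=
  (measurableSet_le_encard _ k).inter (measurableSet_le_encard _ l)

/-- The first one after zero is at `t`. -/
def nextSet (t : ℤ) : Set (ℤ → Bool) := {x | x t = true ∧ ∀ s, 0 < s → s < t → x s = false}

/-- The last one before zero is at `-t`. -/
def prevSet (t : ℤ) : Set (ℤ → Bool) := {x | x (-t) = true ∧ ∀ s, -t < s → s < 0 → x s = false}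

lemma measurableSet_nextSet (t : ℤ) : MeasurableSet (nextSet t) := by
  have : nextSet t = {x | x t = true} ∩ ⋂ s ∈ Ioo 0 t, {x | x s = false} := by
    ext x; simp [nextSet]
  rw [this]
  exact (measurableSet_coord _ _).inter
    (MeasurableSet.biInter (Set.to_countable _) fun s _ => measurableSet_coord _ _)

lemma measurableSet_prevSet (t : ℤ) : MeasurableSet (prevSet t) := by
  have : prevSet t = {x | x (-t) = true} ∩ ⋂ s ∈ Ioo (-t) 0, {x | x s = false} := by
    ext x; simp [prevSet]
  rw [this]
  exact (measurableSet_coord _ _).inter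
    (MeasurableSet.biInter (Set.to_countable _) fun s _ => measurableSet_coord _ _)

lemma cntSet_next (k l : ℕ) : cntSet (k + 1) l = ⋃ n : ℕ, cntSet (k + 1) l ∩ nextSet (n + 1) := by
  rw [← inter_iUnion]
  refine (inter_eq_left.2 fun x hx => ?_).symm
  have hne : {t : ℤ | 0 < t ∧ x t = true}.Nonempty := by
    rw [← Set.encard_pos]
    refine lt_of_lt_of_le ?_ hx.1
    exact_mod_cast Nat.succ_pos k
  have hex : ∃ n : ℕ, x ((n : ℤ) + 1) = true := by
    obtain ⟨t, ht, hxt⟩ := hne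
    refine ⟨(t - 1).toNat, ?_⟩
    rwa [Int.toNat_of_nonneg (by omega), sub_add_cancel]
  classical
  refine mem_iUnion.2 ⟨Nat.find hex, Nat.find_spec hex, fun s h0 h1 => ?_⟩
  have := Nat.find_min hex (m := (s - 1).toNat) (by omega)
  rw [Int.toNat_of_nonneg (by omega), sub_add_cancel] at this
  simpa using this

lemma cntSet_prev (k l : ℕ) : cntSet k (l + 1) = ⋃ n : ℕ, cntSet k (l + 1) ∩ prevSet (n + 1) := by
  rw [← inter_iUnion]
  refine (inter_eq_left.2 fun x hx => ?_).symm
  have hne : {t : ℤ | t < 0 ∧ x t = true}.Nonempty := by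
    rw [← Set.encard_pos]
    refine lt_of_lt_of_le ?_ hx.2
    exact_mod_cast Nat.succ_pos l
  have hex : ∃ n : ℕ, x (-((n : ℤ) + 1)) = true := by
    obtain ⟨t, ht, hxt⟩ := hne
    refine ⟨(-t - 1).toNat, ?_⟩
    rwa [Int.toNat_of_nonneg (by omega), sub_add_cancel, neg_neg]
  classical
  refine mem_iUnion.2 ⟨Nat.find hex, Nat.find_spec hex, fun s h0 h1 => ?_⟩
  have := Nat.find_min hex (m := (-s - 1).toNat) (by omega)
  rw [Int.toNat_of_nonneg (by omega), sub_add_cancel, neg_neg] at this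
  simpa using this

lemma nextSet_disj : Pairwise (Function.onFun Disjoint fun n : ℕ => nextSet (n + 1)) := by
  intro m n hmn
  refine Set.disjoint_left.2 fun x hm hn => ?_
  rcases lt_or_gt_of_ne hmn with h | h
  · have := hn.2 (m + 1) (by omega) (by omega)
    simp [hm.1] at this
  · have := hm.2 (n + 1) (by omega) (by omega)
    simp [hn.1] at this

lemma prevSet_disj : Pairwise (Function.onFun Disjoint fun n : ℕ => prevSet (n + 1)) := by
  intro m n hmn
  refine Set.disjoint_left.2 fun x hm hn => ?_
  rcases lt_or_gt_of_ne hmn with h | h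
  · have := hn.2 (-(m + 1)) (by omega) (by omega)
    exact absurd (hm.1.symm.trans this) (by simp)
  · have := hm.2 (-(n + 1)) (by omega) (by omega)
    exact absurd (hn.1.symm.trans this) (by simp)

lemma encard_shift (t : ℤ) (p : ℤ → Prop) : {s : ℤ | p (s + t)}.encard = {s : ℤ | p s}.encard := by
  rw [← (add_left_injective t).encard_image {s : ℤ | p (s + t)}]
  congr 1
  ext s
  simp only [mem_image, mem_ofPred_eq]
  constructor
  · rintro ⟨a, ha, rfl⟩; exact ha
  · intro h; exact ⟨s - t, by simpa using h, by simp⟩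

lemma shift_key (k l : ℕ) (t : ℤ) (ht : 0 < t) (x : ℤ → Bool) (h0 : x 0 = true) :
    x ∈ cntSet (k + 1) l ∩ nextSet t ↔
      x t = true ∧ shiftSeq t x ∈ cntSet k (l + 1) ∩ prevSet t := by
  have hprev : shiftSeq t x ∈ prevSet t ↔ ∀ s, 0 < s → s < t → x s = false := by
    simp only [prevSet, shiftSeq, mem_ofPred_eq, neg_add_cancel, h0, true_and]
    constructor
    · intro h s hs hst
      simpa using h (s - t) (by omega) (by omega)
    · intro h s hs hst
      exact h (s + t) (by omega) (by omega)
  rw [mem_inter_iff, mem_inter_iff, hprev]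
  by_cases hn : x ∈ nextSet t
  swap
  · have : ¬ (x t = true ∧ ∀ s, 0 < s → s < t → x s = false) := hn
    tauto
  obtain ⟨hn1, hn2⟩ := id hn
  have e1 : {s : ℤ | 0 < s ∧ x s = true} = insert t {s : ℤ | t < s ∧ x s = true} := by
    ext s
    simp only [mem_ofPred_eq, mem_insert_iff]
    constructor
    · rintro ⟨h1, h2⟩
      rcases lt_trichotomy s t with h | h | h
      · have := hn2 s h1 h
        simp [h2] at this
      · exact Or.inl h
      · exact Or.inr ⟨h, h2⟩
    · rintro (rfl | ⟨h1, h2⟩)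
      · exact ⟨ht, hn1⟩
      · exact ⟨by omega, h2⟩
  have e2 : {s : ℤ | s < t ∧ x s = true} = insert 0 {s : ℤ | s < 0 ∧ x s = true} := by
    ext s
    simp only [mem_ofPred_eq, mem_insert_iff]
    constructor
    · rintro ⟨h1, h2⟩
      rcases lt_trichotomy s 0 with h | h | h
      · exact Or.inr ⟨h, h2⟩
      · exact Or.inl h
      · have := hn2 s h h1
        simp [h2] at this
    · rintro (rfl | ⟨h1, h2⟩)
      · exact ⟨ht, h0⟩
      · exact ⟨by omega, h2⟩
  have f1 : {s : ℤ | 0 < s ∧ shiftSeq t x s = true}.encard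
      = {s : ℤ | t < s ∧ x s = true}.encard := by
    rw [← encard_shift t (fun s => t < s ∧ x s = true)]
    congr 1; ext s; simp [shiftSeq]
  have f2 : {s : ℤ | s < 0 ∧ shiftSeq t x s = true}.encard
      = {s : ℤ | s < t ∧ x s = true}.encard := by
    rw [← encard_shift t (fun s => s < t ∧ x s = true)]
    congr 1; ext s; simp [shiftSeq]
  have hc : x ∈ cntSet (k + 1) l ↔ shiftSeq t x ∈ cntSet k (l + 1) := by
    simp only [cntSet, mem_ofPred_eq]
    rw [f1, f2, e1, e2, Set.encard_insert_of_notMem (by simp), Set.encard_insert_of_notMem (by simp)]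
    push_cast
    rw [ENat.add_le_add_iff_right (by simp), ENat.add_le_add_iff_right (by simp)]
  tauto

lemma cnt_step (μ : Measure (ℤ → Bool)) (h0 : ∀ᵐ x ∂μ, x 0 = true)
    (hs : ∀ t : ℤ, (μ.restrict {x | x t = true}).map (shiftSeq t) = μ.restrict {x | x (-t) = true})
    (k l : ℕ) : μ (cntSet (k + 1) l) = μ (cntSet k (l + 1)) := by
  rw [cntSet_next, cntSet_prev, measure_iUnion, measure_iUnion]
  · refine tsum_congr fun n => ?_
    set t : ℤ := n + 1 with htd
    have hB : MeasurableSet (cntSet k (l + 1) ∩ prevSet t) :=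
      (measurableSet_cntSet _ _).inter (measurableSet_prevSet _)
    have h := congrArg (fun m => m (cntSet k (l + 1) ∩ prevSet t)) (hs t)
    rw [Measure.map_apply (measurable_shiftSeq t) hB,
      Measure.restrict_apply (measurable_shiftSeq t hB), Measure.restrict_apply hB] at h
    have e : cntSet k (l + 1) ∩ prevSet t ∩ {x | x (-t) = true} = cntSet k (l + 1) ∩ prevSet t :=
      inter_eq_left.2 fun x hx => hx.2.1
    rw [e] at h
    rw [← h]
    refine measure_congr ?_
    filter_upwards [h0] with x hx
    have := shift_key k l t (by omega) x hx
    refine propext (this.trans ?_)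
    exact and_comm
  · exact fun m n hmn => (prevSet_disj hmn).mono inter_subset_right inter_subset_right
  · exact fun n => (measurableSet_cntSet _ _).inter (measurableSet_prevSet _)
  · exact fun m n hmn => (nextSet_disj hmn).mono inter_subset_right inter_subset_right
  · exact fun n => (measurableSet_cntSet _ _).inter (measurableSet_nextSet _)

lemma measurableSet_cyl (F : Finset ℤ) (ε : ℤ → Bool) :
    MeasurableSet {x : ℤ → Bool | ∀ s ∈ F, x s = ε s} := by
  have : {x : ℤ → Bool | ∀ s ∈ F, x s = ε s} = ⋂ s ∈ F, {x | x s = ε s} := by ext; simp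
  rw [this]
  exact Finset.measurableSet_biInter F fun s _ => measurableSet_coord _ _

/-- Finite measures agreeing on cylinders over large index sets are equal. -/
lemma ext_of_cyl (m1 m2 : Measure (ℤ → Bool)) [IsFiniteMeasure m1] [IsFiniteMeasure m2]
    (G : Finset ℤ)
    (h : ∀ (F : Finset ℤ) (ε : ℤ → Bool), G ⊆ F →
      m1 {x | ∀ s ∈ F, x s = ε s} = m2 {x | ∀ s ∈ F, x s = ε s}) : m1 = m2 := by
  have big : ∀ F : Finset ℤ, G ⊆ F → m1.map F.restrict = m2.map F.restrict := by
    intro F hF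
    refine Measure.ext_of_singleton fun e => ?_
    have hm : Measurable (F.restrict (π := fun _ : ℤ => Bool)) := Finset.measurable_restrict F
    rw [Measure.map_apply hm (measurableSet_singleton e),
      Measure.map_apply hm (measurableSet_singleton e)]
    classical
    have : (F.restrict (π := fun _ : ℤ => Bool)) ⁻¹' {e}
        = {x | ∀ s ∈ F, x s = (fun s => if hs : s ∈ F then e ⟨s, hs⟩ else true) s} := by
      ext x
      simp only [mem_preimage, mem_singleton_iff, mem_ofPred_eq, funext_iff]
      constructor
      · intro h s hs
        simp only [hs, dite_true]
        exact h ⟨s, hs⟩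
      · rintro h ⟨s, hs⟩
        have := h s hs
        simp only [hs, dite_true] at this
        exact this
    rw [this]
    exact h F _ hF
  have all : ∀ F : Finset ℤ, m1.map F.restrict = m2.map F.restrict := by
    intro F
    classical
    have hFG : F ⊆ F ∪ G := Finset.subset_union_left
    have h1 := big (F ∪ G) Finset.subset_union_right
    have h2 := congrArg (Measure.map (Finset.restrict₂ (π := fun _ : ℤ => Bool) hFG)) h1
    rwa [Measure.map_map (Finset.measurable_restrict₂ _) (Finset.measurable_restrict _),
      Measure.map_map (Finset.measurable_restrict₂ _) (Finset.measurable_restrict _),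
      Finset.restrict₂_comp_restrict] at h2
  refine IsProjectiveLimit.unique (P := fun F => m2.map F.restrict) (fun F => all F) (fun F => rfl)

/-- Proposition 3.1: under Assumption 1, for `k, ℓ ∈ ℕ₀`,
`P(S₊ⁱ ≥ k, S₋ⁱ ≥ ℓ) = P(S₊ⁱ ≥ k + ℓ) = P(S₋ⁱ ≥ k + ℓ)`. -/
theorem forward_backward_cluster_size
    {Ω : Type*} [MeasurableSpace Ω] (P : Measure Ω) [IsProbabilityMeasure P]
    (I : ℤ → Ω → Bool) (hI : ∀ t, Measurable (I t))
    {Ωn : ℕ → Type*} [∀ n, MeasurableSpace (Ωn n)]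
    (Pn : ∀ n, Measure (Ωn n)) (hPn : ∀ n, IsProbabilityMeasure (Pn n))
    (In : ∀ n, ℤ → Ωn n → Bool) (hIn : ∀ n t, Measurable (In n t))
    -- `P(I₀ⁿ = 1) > 0` for all `n`
    (hpos : ∀ n, 0 < Pn n {ω | In n 0 ω = true})
    -- stationarity of each `(Iₜⁿ)ₜ`
    (hstat : ∀ n (F : Finset ℤ) (ε : ℤ → Bool) (k : ℤ),
      Pn n {ω | ∀ t ∈ F, In n t ω = ε t} = Pn n {ω | ∀ t ∈ F, In n (t + k) ω = ε t})
    -- convergence of the conditional finite-dimensional distributions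
    (hconv : ∀ (F : Finset ℤ) (ε : ℤ → Bool),
      Tendsto (fun n =>
          Pn n ({ω | ∀ t ∈ F, In n t ω = ε t} ∩ {ω | In n 0 ω = true})
            / Pn n {ω | In n 0 ω = true}) atTop
        (nhds (P {ω | ∀ t ∈ F, I t ω = ε t})))

    (k l : ℕ) :
    P {ω | (k : ℕ∞) ≤ SplusFn I ω ∧ (l : ℕ∞) ≤ SminusFn I ω}
        = P {ω | ((k + l : ℕ) : ℕ∞) ≤ SplusFn I ω}
    ∧ P {ω | ((k + l : ℕ) : ℕ∞) ≤ SplusFn I ω}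
        = P {ω | ((k + l : ℕ) : ℕ∞) ≤ SminusFn I ω} := by
  have hX : Measurable (fun ω t => I t ω) := measurable_pi_lambda _ hI
  set μ : Measure (ℤ → Bool) := P.map (fun ω t => I t ω) with hμ
  have hμp : IsProbabilityMeasure μ := Measure.isProbabilityMeasure_map hX.aemeasurable
  have hcyl : ∀ (F : Finset ℤ) (ε : ℤ → Bool),
      μ {x | ∀ s ∈ F, x s = ε s} = P {ω | ∀ t ∈ F, I t ω = ε t} := by
    intro F ε
    rw [hμ, Measure.map_apply hX (measurableSet_cyl F ε)]
    rfl
  have h0 : ∀ᵐ x ∂μ, x 0 = true := by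
    have h1 := hconv {0} (fun _ => true)
    simp only [Finset.mem_singleton, forall_eq, inter_self] at h1
    have h2 : ∀ n, Pn n {ω | In n 0 ω = true} / Pn n {ω | In n 0 ω = true} = 1 := fun n =>
      ENNReal.div_self (hpos n).ne' (measure_ne_top _ _)
    simp only [h2] at h1
    have h3 : P {ω | I 0 ω = true} = 1 := tendsto_nhds_unique h1 tendsto_const_nhds
    have h4 := hcyl {0} (fun _ => true)
    simp only [Finset.mem_singleton, forall_eq, h3] at h4
    exact (mem_ae_iff_prob_eq_one (measurableSet_coord 0 true)).2 h4
  have hs : ∀ t : ℤ, (μ.restrict {x | x t = true}).map (shiftSeq t)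
      = μ.restrict {x | x (-t) = true} := by
    intro t
    refine ext_of_cyl _ _ {0, -t} fun F ε hF => ?_
    have hF0 : (0 : ℤ) ∈ F := hF (by simp)
    have hFt : -t ∈ F := hF (by simp)
    have hC := measurableSet_cyl F ε
    rw [Measure.map_apply (measurable_shiftSeq t) hC,
      Measure.restrict_apply (measurable_shiftSeq t hC), Measure.restrict_apply hC]
    by_cases hε : ε 0 = true ∧ ε (-t) = true
    · obtain ⟨hε0, hεt⟩ := hε
      have e1 : shiftSeq t ⁻¹' {x | ∀ s ∈ F, x s = ε s} ∩ {x | x t = true}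
          = {x | ∀ s ∈ F.map (addRightEmbedding t), x s = (fun s => ε (s - t)) s} := by
        ext x
        simp only [mem_inter_iff, mem_preimage, mem_ofPred_eq, shiftSeq, Finset.mem_map,
          addRightEmbedding_apply, forall_exists_index, and_imp, forall_apply_eq_imp_iff₂,
          add_sub_cancel_right]
        refine ⟨fun h => h.1, fun h => ⟨h, ?_⟩⟩
        have := h 0 hF0
        rwa [zero_add, hε0] at this
      have e2 : {x : ℤ → Bool | ∀ s ∈ F, x s = ε s} ∩ {x | x (-t) = true}
          = {x | ∀ s ∈ F, x s = ε s} :=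
        inter_eq_left.2 fun x hx => (hx _ hFt).trans hεt
      rw [e1, e2, hcyl, hcyl]
      refine tendsto_nhds_unique (hconv _ _) ((hconv F ε).congr fun n => ?_)
      congr 1
      rw [inter_eq_left.2 (fun ω hω => (hω 0 hF0).trans hε0), hstat n F ε t]
      congr 1
      ext ω
      simp only [mem_inter_iff, mem_ofPred_eq, Finset.mem_map,
          addRightEmbedding_apply, forall_exists_index, and_imp, forall_apply_eq_imp_iff₂,
          add_sub_cancel_right]
      refine ⟨fun h => ⟨h, ?_⟩, fun h => h.1⟩
      have := h (-t) hFt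
      rwa [neg_add_cancel, hεt] at this
    · have z1 : μ (shiftSeq t ⁻¹' {x | ∀ s ∈ F, x s = ε s} ∩ {x | x t = true}) = 0 := by
        refine measure_mono_null (fun x hx => ?_) (mem_ae_iff.1 h0)
        intro hx0
        have a1 := hx.1 0 hF0
        have a2 := hx.1 (-t) hFt
        have a3 : x t = true := hx.2
        have a4 : x 0 = true := hx0
        simp only [shiftSeq, zero_add, neg_add_cancel, a3, a4] at a1 a2
        exact hε ⟨a1.symm, a2.symm⟩
      have z2 : μ ({x | ∀ s ∈ F, x s = ε s} ∩ {x | x (-t) = true}) = 0 := by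
        refine measure_mono_null (fun x hx => ?_) (mem_ae_iff.1 h0)
        intro hx0
        exact hε ⟨(hx.1 0 hF0).symm.trans hx0, (hx.1 (-t) hFt).symm.trans hx.2⟩
      rw [z1, z2]
  have key : ∀ l k : ℕ, μ (cntSet k l) = μ (cntSet (k + l) 0) := by
    intro l
    induction l with
    | zero => intro k; rfl
    | succ l ih =>
      intro k
      rw [← cnt_step μ h0 hs, ih (k + 1)]
      congr 2
      omega
  have hP : ∀ k l : ℕ, P {ω | (k : ℕ∞) ≤ SplusFn I ω ∧ (l : ℕ∞) ≤ SminusFn I ω}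
      = μ (cntSet k l) := by
    intro k l
    rw [hμ, Measure.map_apply hX (measurableSet_cntSet k l)]
    rfl
  have hp : P {ω | ((k + l : ℕ) : ℕ∞) ≤ SplusFn I ω} = μ (cntSet (k + l) 0) := by
    rw [← hP]; simp
  have hm : P {ω | ((k + l : ℕ) : ℕ∞) ≤ SminusFn I ω} = μ (cntSet 0 (k + l)) := by
    rw [← hP]; simp
  rw [hP, hp, hm]
  refine ⟨key l k, ?_⟩
  rw [key (k + l) 0, zero_add]
end
end

section
/- Under Assumption 1, if θ := P(S₊ⁱ = 0) > 0 and P(S₊ⁱ < ∞) = 1, then E(Sⁱ) = E((Sᵗ)²) / E(Sᵗ), where E(Sᵗ) := Σ_{k=1}^∞ k·π_k and E((Sᵗ)²) := Σ_{k=1}^∞ k²·π_k; both sides of the equality may equal infinity. Equivalently, E((Sᵗ)²) = E(Sᵗ)·E(Sⁱ). -/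
open MeasureTheory Filter Set ENNReal

noncomputable section

/-- Path space of binary processes. -/
abbrev Paths : Type := ℤ → Bool

/-- Shift of a path. -/
def shiftPath (t : ℤ) (x : Paths) : Paths := fun s => x (s - t)

lemma measurable_shiftPath (t : ℤ) : Measurable (shiftPath t) :=
  measurable_pi_lambda _ fun s => measurable_pi_apply (s - t)

lemma measurableSet_eval (t : ℤ) (b : Bool) : MeasurableSet {x : Paths | x t = b} := by
  have h : Measurable (fun x : Paths => x t) := measurable_pi_apply t
  exact h (measurableSet_singleton b)

lemma eval_mem_cyl (t : ℤ) : {x : Paths | x t = true} ∈ measurableCylinders (fun _ : ℤ => Bool) := by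
  rw [mem_measurableCylinders]
  refine ⟨{t}, {y | y ⟨t, by simp⟩ = true}, (Set.toFinite _).measurableSet, ?_⟩
  ext x
  simp [mem_cylinder]

lemma shift_mem_cyl (t : ℤ) (C : Set Paths) (hC : C ∈ measurableCylinders (fun _ : ℤ => Bool)) :
    shiftPath t ⁻¹' C ∈ measurableCylinders (fun _ : ℤ => Bool) := by
  rw [mem_measurableCylinders] at hC ⊢
  obtain ⟨s, S, hS, rfl⟩ := hC
  refine ⟨s.image (fun i => i - t),
    {y | (fun i : s => y ⟨i.1 - t, Finset.mem_image_of_mem _ i.2⟩) ∈ S},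
    (Set.toFinite _).measurableSet, ?_⟩
  ext x
  simp only [mem_preimage, mem_cylinder, mem_ofPred_eq]
  rfl

lemma cylinder_sum (μ : Measure Paths) (F : Finset ℤ) (S : Set ((i : F) → Bool)) :
    μ (cylinder F S) = ∑ b ∈ S.toFinite.toFinset, μ (cylinder F {b}) := by
  have h : ∀ T : Set ((i : F) → Bool), μ (cylinder F T) = (μ.map F.restrict) T := by
    intro T
    rw [Measure.map_apply (Finset.measurable_restrict F) (Set.toFinite _).measurableSet]
    rfl
  simp_rw [h]
  rw [sum_measure_singleton]
  simp

lemma cylinder_singleton (F : Finset ℤ) (b : (i : F) → Bool) :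
    (cylinder F {b} : Set Paths) =
      {x | ∀ t ∈ F, x t = (fun t : ℤ => if h : t ∈ F then b ⟨t, h⟩ else true) t} := by
  ext x
  simp only [mem_cylinder, mem_singleton_iff, mem_ofPred_eq, funext_iff, Subtype.forall]
  refine forall₂_congr fun t ht => ?_
  simp [ht]
  

/-- Stationarity as invariance of the law. -/
lemma stat_inv (μ : Measure Paths) [IsProbabilityMeasure μ]
    (h : ∀ (F : Finset ℤ) (ε : ℤ → Bool) (k : ℤ),
      μ {x | ∀ t ∈ F, x t = ε t} = μ {x | ∀ t ∈ F, x (t + k) = ε t})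
    (t : ℤ) (C : Set Paths) (hC : C ∈ measurableCylinders (fun _ : ℤ => Bool)) :
    μ C = μ (shiftPath t ⁻¹' C) := by
  obtain ⟨F, S, -, rfl⟩ := (mem_measurableCylinders _).1 hC
  have hm : ∀ T : Set ((i : F) → Bool), MeasurableSet (cylinder F T : Set Paths) := fun T =>
    MeasurableSet.cylinder F (Set.toFinite _).measurableSet
  rw [← Measure.map_apply (measurable_shiftPath t) (hm S), cylinder_sum, cylinder_sum]
  refine Finset.sum_congr rfl fun b _ => ?_
  rw [Measure.map_apply (measurable_shiftPath t) (hm _), cylinder_singleton, h _ _ (-t)]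
  rfl

lemma conv_cyl (Q : Measure Paths) (Qn : ℕ → Measure Paths)
    (hconv : ∀ (F : Finset ℤ) (ε : ℤ → Bool),
      Tendsto (fun n => Qn n ({x | ∀ t ∈ F, x t = ε t} ∩ {x | x 0 = true})
            / Qn n {x | x 0 = true}) atTop (nhds (Q {x | ∀ t ∈ F, x t = ε t})))
    (C : Set Paths) (hC : C ∈ measurableCylinders (fun _ : ℤ => Bool)) :
    Tendsto (fun n => Qn n (C ∩ {x | x 0 = true}) / Qn n {x | x 0 = true}) atTop
      (nhds (Q C)) := by
  obtain ⟨F, S, -, rfl⟩ := (mem_measurableCylinders _).1 hC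
  have hm := measurableSet_eval 0 true
  simp_rw [← Measure.restrict_apply' hm]
  rw [cylinder_sum Q]
  simp_rw [fun n => cylinder_sum ((Qn n).restrict {x | x 0 = true}) F S, div_eq_mul_inv,
    Finset.sum_mul]
  refine tendsto_finsetSum _ fun b _ => ?_
  simp_rw [cylinder_singleton, Measure.restrict_apply' hm, ← div_eq_mul_inv]
  exact hconv F _

/-- Time change formula. -/
lemma time_change (Q : Measure Paths) [IsProbabilityMeasure Q]
    (Qn : ℕ → Measure Paths) [∀ n, IsProbabilityMeasure (Qn n)]
    (hstat : ∀ n (F : Finset ℤ) (ε : ℤ → Bool) (k : ℤ),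
      Qn n {x | ∀ t ∈ F, x t = ε t} = Qn n {x | ∀ t ∈ F, x (t + k) = ε t})
    (hconv : ∀ (F : Finset ℤ) (ε : ℤ → Bool),
      Tendsto (fun n => Qn n ({x | ∀ t ∈ F, x t = ε t} ∩ {x | x 0 = true})
            / Qn n {x | x 0 = true}) atTop (nhds (Q {x | ∀ t ∈ F, x t = ε t})))
    (t : ℤ) (A : Set Paths) (hA : MeasurableSet A) :
    Q (A ∩ {x | x t = true}) = Q (shiftPath t ⁻¹' A ∩ {x | x (-t) = true}) := by
  have key : ∀ C ∈ measurableCylinders (fun _ : ℤ => Bool),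
      Q (C ∩ {x | x t = true}) = Q (shiftPath t ⁻¹' C ∩ {x | x (-t) = true}) := by
    intro C hC
    have h1 := conv_cyl Q Qn hconv _ (inter_mem_measurableCylinders hC (eval_mem_cyl t))
    have h2 := conv_cyl Q Qn hconv _
      (inter_mem_measurableCylinders (shift_mem_cyl t C hC) (eval_mem_cyl (-t)))
    refine tendsto_nhds_unique h1 (h2.congr fun n => ?_)
    congr 1
    rw [stat_inv (Qn n) (hstat n) t (C ∩ {x | x t = true} ∩ {x | x 0 = true})
      (inter_mem_measurableCylinders (inter_mem_measurableCylinders hC (eval_mem_cyl t))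
        (eval_mem_cyl 0))]
    congr 1
    ext x
    simp only [shiftPath, mem_inter_iff, mem_preimage, mem_ofPred_eq, sub_self, zero_sub]
    tauto
  have hm := measurableSet_eval t true
  have hm' := measurableSet_eval (-t) true
  have hT := measurable_shiftPath t
  have heq : Q.restrict {x | x t = true} = (Q.restrict {x | x (-t) = true}).map (shiftPath t) := by
    refine ext_of_generate_finite _ (generateFrom_measurableCylinders (α := fun _ : ℤ => Bool)).symm
      isPiSystem_measurableCylinders ?_ ?_
    · intro C hC
      rw [Measure.map_apply hT (MeasurableSet.of_mem_measurableCylinders hC), Measure.restrict_apply' hm,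
        Measure.restrict_apply' hm', key C hC]
    · rw [Measure.map_apply hT MeasurableSet.univ, Measure.restrict_apply' hm,
        Measure.restrict_apply' hm', key _ (univ_mem_measurableCylinders _)]
  have := congrArg (fun μ => μ A) heq
  simpa only [Measure.map_apply hT hA, Measure.restrict_apply' hm,
        Measure.restrict_apply' hm'] using this

/-- Cluster size on the path space. -/
def pathSize (x : Paths) : ℕ∞ := {t : ℤ | x t = true}.encard

lemma pathSize_eq_tsum (x : Paths) :
    (pathSize x : ℝ≥0∞) = ∑' t : ℤ, ({y : Paths | y (-t) = true}.indicator 1 x : ℝ≥0∞) := by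
  rw [pathSize, ← ENNReal.tsum_set_one, tsum_subtype _ (fun _ => (1 : ℝ≥0∞)),
    ← (Equiv.neg ℤ).tsum_eq]
  rfl

lemma measurable_pathSize : Measurable (fun x => (pathSize x : ℝ≥0∞)) := by
  simp_rw [pathSize_eq_tsum]
  exact Measurable.ennreal_tsum fun t => measurable_one.indicator (measurableSet_eval _ _)

lemma measurableSet_size (k : ℕ∞) : MeasurableSet {x | pathSize x = k} := by
  have : {x | pathSize x = k} = (fun x => (pathSize x : ℝ≥0∞)) ⁻¹' {(k : ℝ≥0∞)} := by
    ext x; simp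
  rw [this]
  exact measurable_pathSize (measurableSet_singleton _)

lemma pathSize_shift (t : ℤ) (x : Paths) : pathSize (shiftPath t x) = pathSize x := by
  unfold pathSize
  have : {s : ℤ | x s = true} = (Equiv.subRight t) '' {s : ℤ | shiftPath t x s = true} := by
    ext s
    simp only [shiftPath, mem_image, mem_ofPred_eq, Equiv.subRight_apply]
    constructor
    · intro h
      exact ⟨s + t, by simpa using h, by simp⟩
    · rintro ⟨u, hu, rfl⟩
      exact hu
  rw [this, (Equiv.subRight t).injective.encard_image]

lemma counting (Q : Measure Paths) [IsProbabilityMeasure Q]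
    (htc : ∀ (t : ℤ) (A : Set Paths), MeasurableSet A →
      Q (A ∩ {x | x t = true}) = Q (shiftPath t ⁻¹' A ∩ {x | x (-t) = true}))
    (L : ℤ → Set Paths) (hL : ∀ t, MeasurableSet (L t)) (hL1 : ∀ t, ∀ x ∈ L t, x t = true)
    (hdisj : Pairwise (Function.onFun Disjoint L)) (hshift : ∀ t, shiftPath t ⁻¹' L t = L 0)
    (k : ℕ∞) :
    Q ({x | pathSize x = k} ∩ ⋃ t, L t) = k * Q ({x | pathSize x = k} ∩ L 0) := by
  have hA := measurableSet_size k
  rw [inter_iUnion, measure_iUnion]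
  · have h1 : ∀ t, Q ({x | pathSize x = k} ∩ L t) =
        ∫⁻ x in {x | pathSize x = k} ∩ L 0, {y : Paths | y (-t) = true}.indicator 1 x ∂Q := by
      intro t
      rw [lintegral_indicator_one (measurableSet_eval _ _),
        Measure.restrict_apply (measurableSet_eval _ _)]
      have e : {x | pathSize x = k} ∩ L t = ({x | pathSize x = k} ∩ L t) ∩ {x | x t = true} := by
        rw [eq_comm, inter_eq_left]
        exact fun x hx => hL1 t x hx.2
      rw [e, htc t _ (hA.inter (hL t)), preimage_inter, hshift, inter_comm]
      congr 3
      ext x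
      simp [pathSize_shift]
    rw [tsum_congr h1]
    rw [← lintegral_tsum fun t =>
      (measurable_one.indicator (measurableSet_eval _ _)).aemeasurable]
    simp_rw [← pathSize_eq_tsum]
    rw [setLIntegral_congr_fun (g := fun _ => (k : ℝ≥0∞)) (hA.inter (hL 0)), setLIntegral_const]
    intro x hx
    have : pathSize x = k := hx.1
    simp [this]
  · intro s t hst
    exact (hdisj hst).mono inter_subset_right inter_subset_right
  · exact fun t => hA.inter (hL t)

/-- The first cluster point is `t`. -/
def firstAt (t : ℤ) : Set Paths := {x | x t = true ∧ ∀ s < t, x s = false}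

/-- The last cluster point is `t`. -/
def lastAt (t : ℤ) : Set Paths := {x | x t = true ∧ ∀ s > t, x s = false}

lemma measurableSet_firstAt (t : ℤ) : MeasurableSet (firstAt t) := by
  have : firstAt t = {x | x t = true} ∩ ⋂ s, ⋂ (_ : s < t), {x | x s = false} := by
    ext x; simp [firstAt]
  rw [this]
  exact (measurableSet_eval _ _).inter
    (MeasurableSet.iInter fun s => MeasurableSet.iInter fun _ => measurableSet_eval _ _)

lemma measurableSet_lastAt (t : ℤ) : MeasurableSet (lastAt t) := by
  have : lastAt t = {x | x t = true} ∩ ⋂ s, ⋂ (_ : s > t), {x | x s = false} := by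
    ext x; simp [lastAt]
  rw [this]
  exact (measurableSet_eval _ _).inter
    (MeasurableSet.iInter fun s => MeasurableSet.iInter fun _ => measurableSet_eval _ _)

lemma counting_first (Q : Measure Paths) [IsProbabilityMeasure Q]
    (htc : ∀ (t : ℤ) (A : Set Paths), MeasurableSet A →
      Q (A ∩ {x | x t = true}) = Q (shiftPath t ⁻¹' A ∩ {x | x (-t) = true})) (k : ℕ∞) :
    Q ({x | pathSize x = k} ∩ ⋃ t, firstAt t) = k * Q ({x | pathSize x = k} ∩ firstAt 0) := by
  refine counting Q htc firstAt measurableSet_firstAt (fun t x hx => hx.1) ?_ ?_ k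
  · intro s t hst
    rw [Function.onFun, Set.disjoint_left]
    rintro x ⟨h1, h2⟩ ⟨h3, h4⟩
    rcases lt_or_gt_of_ne hst with h | h
    · simp [h4 s h] at h1
    · simp [h2 t h] at h3
  · intro t
    ext x
    simp only [firstAt, shiftPath, mem_preimage, mem_ofPred_eq, sub_self]
    refine and_congr_right fun _ => ⟨fun h s hs => ?_, fun h s hs => h _ (by omega)⟩
    simpa using h (s + t) (by omega)

lemma counting_last (Q : Measure Paths) [IsProbabilityMeasure Q]
    (htc : ∀ (t : ℤ) (A : Set Paths), MeasurableSet A →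
      Q (A ∩ {x | x t = true}) = Q (shiftPath t ⁻¹' A ∩ {x | x (-t) = true})) (k : ℕ∞) :
    Q ({x | pathSize x = k} ∩ ⋃ t, lastAt t) = k * Q ({x | pathSize x = k} ∩ lastAt 0) := by
  refine counting Q htc lastAt measurableSet_lastAt (fun t x hx => hx.1) ?_ ?_ k
  · intro s t hst
    rw [Function.onFun, Set.disjoint_left]
    rintro x ⟨h1, h2⟩ ⟨h3, h4⟩
    rcases lt_or_gt_of_ne hst with h | h
    · simp [h2 t h] at h3
    · simp [h4 s h] at h1
  · intro t
    ext x
    simp only [lastAt, shiftPath, mem_preimage, mem_ofPred_eq, sub_self]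
    refine and_congr_right fun _ => ⟨fun h s hs => ?_, fun h s hs => h _ (by omega)⟩
    simpa using h (s + t) (by omega)

lemma path_result (Q : Measure Paths) [IsProbabilityMeasure Q]
    (htc : ∀ (t : ℤ) (A : Set Paths), MeasurableSet A →
      Q (A ∩ {x | x t = true}) = Q (shiftPath t ⁻¹' A ∩ {x | x (-t) = true}))
    (h0 : ∀ᵐ x ∂Q, x 0 = true)
    (hfin : ∀ᵐ x ∂Q, {t : ℤ | 0 < t ∧ x t = true}.Finite) :
    (∀ᵐ x ∂Q, pathSize x ≠ ⊤) ∧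
    ∀ k : ℕ, Q {x | pathSize x = k} = k * Q ({x | pathSize x = k} ∩ {x | ∀ t < 0, x t = false}) := by
  constructor
  · have hc := counting_last Q htc ⊤
    have hz : Q ({x | pathSize x = ⊤} ∩ lastAt 0) = 0 := by
      by_contra hne
      rw [ENat.toENNReal_top, ENNReal.top_mul hne] at hc
      exact measure_ne_top Q _ hc
    rw [hz, mul_zero] at hc
    have hc' : ∀ᵐ x ∂Q, ¬ (x ∈ {x | pathSize x = ⊤} ∩ ⋃ t, lastAt t) := by
      rw [ae_iff]; simp only [not_not]; exact hc
    filter_upwards [hc', h0, hfin] with x hx hx0 hxf htop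
    refine hx ⟨htop, ?_⟩
    obtain ⟨B, hB⟩ := hxf.bddAbove
    obtain ⟨u, hu, hu'⟩ := Int.exists_greatest_of_bdd (P := fun t => x t = true)
      ⟨max B 0, fun z hz => by
        by_cases h : 0 < z
        · exact le_max_of_le_left (hB ⟨h, hz⟩)
        · exact le_max_of_le_right (not_lt.1 h)⟩ ⟨0, hx0⟩
    refine mem_iUnion.2 ⟨u, hu, fun s hs => ?_⟩
    by_contra h
    have := hu' s (by simpa using h)
    omega
  · intro k
    have hc := counting_first Q htc k
    have e1 : Q {x | pathSize x = k} = Q ({x | pathSize x = k} ∩ ⋃ t, firstAt t) := by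
      refine measure_congr ?_
      filter_upwards [h0] with x hx0
      refine propext ⟨fun h => ⟨h, ?_⟩, fun h => h.1⟩
      have hsz : pathSize x = k := h
      have hf : {t : ℤ | x t = true}.Finite := by
        refine Set.finite_of_encard_eq_coe (k := k) hsz
      obtain ⟨B, hB⟩ := hf.bddBelow
      obtain ⟨u, hu, hu'⟩ := Int.exists_least_of_bdd (P := fun t => x t = true)
        ⟨B, fun z hz => hB hz⟩ ⟨0, hx0⟩
      refine mem_iUnion.2 ⟨u, hu, fun s hs => ?_⟩
      by_contra h
      have := hu' s (by simpa using h)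
      omega
    have e2 : Q ({x | pathSize x = k} ∩ firstAt 0) =
        Q ({x | pathSize x = k} ∩ {x | ∀ t < 0, x t = false}) := by
      refine measure_congr ?_
      filter_upwards [h0] with x hx0
      exact propext ⟨fun h => ⟨h.1, h.2.2⟩, fun h => ⟨h.1, hx0, h.2⟩⟩
    rw [e1, hc, e2]
    simp

/-- Theorem 4.2(b), Equation (4.10): under Assumption 1, if `θ = P(S₊ⁱ = 0) > 0`
and `P(S₊ⁱ < ∞) = 1`, then `E(Sⁱ) = E((Sᵗ)²) / E(Sᵗ)` (both sides possibly
infinite); equivalently `E((Sᵗ)²) = E(Sᵗ) · E(Sⁱ)`. -/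
theorem inspected_mean_eq_second_moment_ratio
    {Ω : Type*} [MeasurableSpace Ω] (P : Measure Ω) [IsProbabilityMeasure P]
    (I : ℤ → Ω → Bool) (hI : ∀ t, Measurable (I t))
    {Ωn : ℕ → Type*} [∀ n, MeasurableSpace (Ωn n)]
    (Pn : ∀ n, Measure (Ωn n)) (hPn : ∀ n, IsProbabilityMeasure (Pn n))
    (In : ∀ n, ℤ → Ωn n → Bool) (hIn : ∀ n t, Measurable (In n t))
    -- `P(I₀ⁿ = 1) > 0` for all `n`
    (hpos : ∀ n, 0 < Pn n {ω | In n 0 ω = true})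
    -- stationarity of each `(Iₜⁿ)ₜ`
    (hstat : ∀ n (F : Finset ℤ) (ε : ℤ → Bool) (k : ℤ),
      Pn n {ω | ∀ t ∈ F, In n t ω = ε t} = Pn n {ω | ∀ t ∈ F, In n (t + k) ω = ε t})
    -- convergence of the conditional finite-dimensional distributions
    (hconv : ∀ (F : Finset ℤ) (ε : ℤ → Bool),
      Tendsto (fun n =>
          Pn n ({ω | ∀ t ∈ F, In n t ω = ε t} ∩ {ω | In n 0 ω = true})
            / Pn n {ω | In n 0 ω = true}) atTop
        (nhds (P {ω | ∀ t ∈ F, I t ω = ε t})))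

    (hθ : 0 < P {ω | SplusFn I ω = 0}) (hfin : P {ω | SplusFn I ω ≠ ⊤} = 1) :
    (∫⁻ ω, (SiFn I ω : ℝ≥0∞) ∂P) = (∑' k : ℕ, (k : ℝ≥0∞) ^ 2 * (P ({ω | SiFn I ω = ((k : ℕ) : ℕ∞)} ∩ {ω | SminusFn I ω = 0}) / P {ω | SminusFn I ω = 0})) / (∑' k : ℕ, (k : ℝ≥0∞) * (P ({ω | SiFn I ω = ((k : ℕ) : ℕ∞)} ∩ {ω | SminusFn I ω = 0}) / P {ω | SminusFn I ω = 0}))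
    ∧ (∑' k : ℕ, (k : ℝ≥0∞) ^ 2 * (P ({ω | SiFn I ω = ((k : ℕ) : ℕ∞)} ∩ {ω | SminusFn I ω = 0}) / P {ω | SminusFn I ω = 0})) = (∑' k : ℕ, (k : ℝ≥0∞) * (P ({ω | SiFn I ω = ((k : ℕ) : ℕ∞)} ∩ {ω | SminusFn I ω = 0}) / P {ω | SminusFn I ω = 0})) * (∫⁻ ω, (SiFn I ω : ℝ≥0∞) ∂P) := by
  classical
  have hIm : Measurable (fun ω t => I t ω) := measurable_pi_lambda _ hI
  have hInm : ∀ n, Measurable (fun ω t => In n t ω) := fun n => measurable_pi_lambda _ (hIn n)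
  have hcm : ∀ (F : Finset ℤ) (ε : ℤ → Bool) (k : ℤ),
      MeasurableSet {x : Paths | ∀ t ∈ F, x (t + k) = ε t} := by
    intro F ε k
    have : {x : Paths | ∀ t ∈ F, x (t + k) = ε t} = ⋂ t ∈ F, {x | x (t + k) = ε t} := by
      ext x; simp
    rw [this]
    exact Finset.measurableSet_biInter _ fun t _ => measurableSet_eval _ _
  have hcm0 : ∀ (F : Finset ℤ) (ε : ℤ → Bool),
      MeasurableSet {x : Paths | ∀ t ∈ F, x t = ε t} := by
    intro F ε
    simpa using hcm F ε 0
  set Q : Measure Paths := P.map (fun ω t => I t ω) with hQ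
  set Qn : ℕ → Measure Paths := fun n => (Pn n).map (fun ω t => In n t ω) with hQn
  have : IsProbabilityMeasure Q := Measure.isProbabilityMeasure_map hIm.aemeasurable
  have : ∀ n, IsProbabilityMeasure (Qn n) := fun n =>
    Measure.isProbabilityMeasure_map (hInm n).aemeasurable
  have htc := time_change Q Qn
    (by
      intro n F ε k
      rw [hQn]
      simp only
      rw [Measure.map_apply (hInm n) (hcm0 F ε), Measure.map_apply (hInm n) (hcm F ε k)]
      exact hstat n F ε k)
    (by
      intro F ε
      rw [hQ, Measure.map_apply hIm (hcm0 F ε)]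
      refine (hconv F ε).congr fun n => ?_
      rw [hQn]
      simp only
      rw [Measure.map_apply (hInm n) ((hcm0 F ε).inter (measurableSet_eval _ _)),
        Measure.map_apply (hInm n) (measurableSet_eval _ _)]
      rfl)
  have h0P : P {ω | I 0 ω = true} = 1 := by
    have h := hconv {0} (fun _ => true)
    simp only [Finset.mem_singleton, forall_eq, inter_self] at h
    refine tendsto_nhds_unique h (tendsto_const_nhds.congr fun n => ?_)
    rw [ENNReal.div_self (hpos n).ne' (measure_ne_top _ _)]
  have h0 : ∀ᵐ x ∂Q, x 0 = true := by
    rw [hQ, ae_map_iff hIm.aemeasurable (measurableSet_eval _ _)]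
    exact (prob_compl_eq_zero_iff ((hI 0) (measurableSet_singleton true))).2 h0P
  have hfinm : MeasurableSet {x : Paths | {t : ℤ | 0 < t ∧ x t = true}.Finite} := by
    have : {x : Paths | {t : ℤ | 0 < t ∧ x t = true}.Finite} =
        ⋃ B : ℤ, ⋂ t : ℤ, ⋂ (_ : 0 < t ∧ B < t), {x | x t = false} := by
      ext x
      simp only [mem_ofPred_eq, mem_iUnion, mem_iInter]
      constructor
      · intro h
        obtain ⟨B, hB⟩ := h.bddAbove
        refine ⟨B, fun t ht => ?_⟩
        by_contra hne
        have : t ≤ B := hB ⟨ht.1, by simpa using hne⟩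
        omega
      · rintro ⟨B, hB⟩
        refine (Set.finite_Icc 0 B).subset fun t ht => ⟨ht.1.le, ?_⟩
        by_contra hlt
        have h1 := hB t ⟨ht.1, not_le.1 hlt⟩
        have h2 : x t = true := ht.2
        simp [h1] at h2
    rw [this]
    exact MeasurableSet.iUnion fun B => MeasurableSet.iInter fun t =>
      MeasurableSet.iInter fun _ => measurableSet_eval _ _
  have hfinQ : ∀ᵐ x ∂Q, {t : ℤ | 0 < t ∧ x t = true}.Finite := by
    rw [hQ, ae_map_iff hIm.aemeasurable hfinm]
    have e : {ω | SplusFn I ω ≠ ⊤} =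
        (fun ω t => I t ω) ⁻¹' {x : Paths | {t : ℤ | 0 < t ∧ x t = true}.Finite} := by
      ext ω
      simp [SplusFn]
    rw [e] at hfin
    exact (prob_compl_eq_zero_iff (hIm hfinm)).2 hfin
  obtain ⟨hT, hk⟩ := path_result Q htc h0 hfinQ
  have hnegm : MeasurableSet {x : Paths | ∀ t < 0, x t = false} := by
    have : {x : Paths | ∀ t < 0, x t = false} = ⋂ t, ⋂ (_ : t < 0), {x | x t = false} := by
      ext x; simp
    rw [this]
    exact MeasurableSet.iInter fun t => MeasurableSet.iInter fun _ => measurableSet_eval _ _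
  have eminus : {ω | SminusFn I ω = 0} =
      (fun ω t => I t ω) ⁻¹' {x : Paths | ∀ t < 0, x t = false} := by
    ext ω
    simp [SminusFn, Set.eq_empty_iff_forall_notMem]
  set p := P {ω | SminusFn I ω = 0} with hp
  have ePk : ∀ k : ℕ, P ({ω | SiFn I ω = ((k : ℕ) : ℕ∞)} ∩ {ω | SminusFn I ω = 0}) =
      Q ({x | pathSize x = k} ∩ {x | ∀ t < 0, x t = false}) := by
    intro k
    rw [eminus, hQ, Measure.map_apply hIm ((measurableSet_size _).inter hnegm)]
    rfl
  have eSi : (∫⁻ ω, (SiFn I ω : ℝ≥0∞) ∂P) = ∫⁻ x, (pathSize x : ℝ≥0∞) ∂Q := by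
    rw [hQ, lintegral_map measurable_pathSize hIm]
    rfl
  have hU : (⋃ k : ℕ, {x | pathSize x = k}) =ᵐ[Q] univ := by
    rw [eventuallyEq_univ]
    filter_upwards [hT] with x hx
    obtain ⟨m, hm⟩ := ENat.ne_top_iff_exists.1 hx
    exact mem_iUnion.2 ⟨m, hm.symm⟩
  have hdisj : Pairwise (Function.onFun Disjoint fun k : ℕ => {x | pathSize x = k}) := by
    intro i j hij
    rw [Function.onFun, Set.disjoint_left]
    intro x hi hj
    have hi' : pathSize x = i := hi
    have hj' : pathSize x = j := hj
    rw [hi'] at hj'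
    exact hij (by exact_mod_cast hj')
  have sum1 : ∑' k : ℕ, Q {x | pathSize x = k} = 1 := by
    rw [← measure_iUnion hdisj fun k => measurableSet_size _, measure_congr hU, measure_univ]
  have sum2 : ∫⁻ x, (pathSize x : ℝ≥0∞) ∂Q = ∑' k : ℕ, (k : ℝ≥0∞) * Q {x | pathSize x = k} := by
    rw [← setLIntegral_univ, ← setLIntegral_congr hU,
      lintegral_iUnion (fun k => measurableSet_size _) hdisj]
    refine tsum_congr fun k => ?_
    rw [setLIntegral_congr_fun (g := fun _ => (k : ℝ≥0∞)) (measurableSet_size _),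
      setLIntegral_const]
    intro x hx
    have : pathSize x = k := hx
    simp [this]
  have hp0 : p ≠ 0 := by
    intro h
    have : ∀ k : ℕ, Q {x | pathSize x = k} = 0 := by
      intro k
      rw [hk k, ← ePk k, measure_mono_null inter_subset_right h, mul_zero]
    simp [this] at sum1
  have hpt : p ≠ ⊤ := measure_ne_top _ _
  have E1 : (∑' k : ℕ, (k : ℝ≥0∞) * (P ({ω | SiFn I ω = ((k : ℕ) : ℕ∞)} ∩
      {ω | SminusFn I ω = 0}) / p)) = p⁻¹ := by
    simp_rw [ePk, div_eq_mul_inv, ← mul_assoc, ← hk]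
    rw [ENNReal.tsum_mul_right, sum1, one_mul]
  have E2 : (∑' k : ℕ, (k : ℝ≥0∞) ^ 2 * (P ({ω | SiFn I ω = ((k : ℕ) : ℕ∞)} ∩
      {ω | SminusFn I ω = 0}) / p)) = p⁻¹ * (∫⁻ ω, (SiFn I ω : ℝ≥0∞) ∂P) := by
    simp_rw [ePk, div_eq_mul_inv, sq, ← mul_assoc, mul_assoc (_ : ℝ≥0∞) (_ : ℝ≥0∞) (Q _), ← hk]
    rw [ENNReal.tsum_mul_right, eSi, sum2, mul_comm]
  rw [E1, E2]
  refine ⟨?_, rfl⟩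
  rw [mul_comm, ENNReal.mul_div_cancel_right (ENNReal.inv_ne_zero.2 hpt)
    (ENNReal.inv_ne_top.2 hp0)]
end
end
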